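/- Let U be a nonempty open connected subset of ℝⁿ, and let f, g : ℝⁿ → ℝ be infinitely differentiable (C^∞). Assume f has no zeros of infinite order in U, i.e., for every point x₀ ∈ U there exists a natural number k such that the k-th iterated Fréchet derivative of f at x₀ is nonzero. If g(x)² = f(x)² for all x ∈ U, then either g(x) = f(x) for all x ∈ U or g(x) = -f(x) for all x ∈ U. -/

import Mathlib

open Filter Topology

section SmoothProducts

variable {E : Type*} [NormedAddCommGroup E] [NormedSpace ℝ E]

/-- The iterated derivatives of a smooth function, evaluated at a fixed vector, are smooth. -/
lemma contDiff_iteratedFDeriv_apply {u : E → ℝ} (hu : ContDiff ℝ (⊤ : ℕ∞) u) {k : ℕ}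
    (v : Fin k → E) : ContDiff ℝ (⊤ : ℕ∞) (fun y ↦ iteratedFDeriv ℝ k u y v) :=
  (ContinuousMultilinearMap.apply ℝ (fun _ : Fin k ↦ E) ℝ v).contDiff.comp
    (hu.iteratedFDeriv_right (m := (⊤ : ℕ∞)) (by exact_mod_cast le_top))

lemma iteratedFDeriv_succ_apply_eq_fderiv_apply {u : E → ℝ} (hu : ContDiff ℝ (⊤ : ℕ∞) u) (x : E)
    {k : ℕ} (v : Fin (k + 1) → E) :
    iteratedFDeriv ℝ (k + 1) u x v =
      fderiv ℝ (fun y ↦ iteratedFDeriv ℝ k u y (Fin.tail v)) x (v 0) := by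
  have hd : DifferentiableAt ℝ (iteratedFDeriv ℝ k u) x :=
    (hu.differentiable_iteratedFDeriv (by exact_mod_cast ENat.natCast_lt_top k)).differentiableAt
  have h := ((ContinuousMultilinearMap.apply ℝ (fun _ : Fin k ↦ E) ℝ
    (Fin.tail v)).hasFDerivAt.comp x hd.hasFDerivAt).fderiv
  rw [iteratedFDeriv_succ_apply_left]
  exact (congrArg (fun L ↦ L (v 0)) h).symm

/-- The iterated derivatives of a smooth function are invariant under exchange of two consecutive
arguments. -/
lemma iteratedFDeriv_comp_swap_castSucc_succ {u : E → ℝ} (hu : ContDiff ℝ (⊤ : ℕ∞) u) {k : ℕ}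
    (i : Fin k) (x : E) (v : Fin (k + 1) → E) :
    iteratedFDeriv ℝ (k + 1) u x (v ∘ Equiv.swap i.castSucc i.succ) =
      iteratedFDeriv ℝ (k + 1) u x v := by
  induction k generalizing x with
  | zero => exact i.elim0
  | succ k ih =>
    cases i using Fin.cases with
    | zero =>
      have key (v : Fin (k + 2) → E) : iteratedFDeriv ℝ (k + 2) u x v =
          fderiv ℝ (fderiv ℝ (fun y ↦ iteratedFDeriv ℝ k u y (Fin.tail (Fin.tail v)))) x
            (v 0) (v 1) := by
        have hd : DifferentiableAt ℝ
            (fderiv ℝ (fun y ↦ iteratedFDeriv ℝ k u y (Fin.tail (Fin.tail v)))) x :=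
          ((contDiff_iteratedFDeriv_apply hu _).fderiv_right (m := (⊤ : ℕ∞))
            (by exact_mod_cast le_top)).differentiable (by simp) |>.differentiableAt
        rw [iteratedFDeriv_succ_apply_eq_fderiv_apply hu]
        simp only [iteratedFDeriv_succ_apply_eq_fderiv_apply hu]
        rw [fderiv_clm_apply hd (by fun_prop)]
        simp [Fin.tail]
      have htail : Fin.tail (Fin.tail (v ∘ Equiv.swap (0 : Fin (k + 2)) 1)) =
          Fin.tail (Fin.tail v) := by
        ext1 j
        simp only [Fin.tail, Function.comp_apply]
        rw [Equiv.swap_apply_of_ne_of_ne] <;> simp [Fin.ext_iff]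
      have hsymm := (contDiff_iteratedFDeriv_apply hu
        (Fin.tail (Fin.tail v))).contDiffAt (x := x) |>.isSymmSndFDerivAt
          (by simpa using (WithTop.coe_le_coe.2 le_top : ((2 : ℕ∞) : WithTop ℕ∞) ≤ (⊤ : ℕ∞)))
      change iteratedFDeriv ℝ (k + 2) u x (v ∘ Equiv.swap (0 : Fin (k + 2)) 1) = _
      rw [key, key, htail]
      simpa using hsymm (v 1) (v 0)
    | succ j =>
      have htail : Fin.tail (v ∘ Equiv.swap j.succ.castSucc j.succ.succ) =
          Fin.tail v ∘ Equiv.swap j.castSucc j.succ := by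
        ext1 l
        simp only [Fin.tail, Function.comp_apply, ← Fin.succ_castSucc]
        rw [← (Fin.succ_injective _).map_swap]
      rw [iteratedFDeriv_succ_apply_eq_fderiv_apply hu,
        iteratedFDeriv_succ_apply_eq_fderiv_apply hu, htail]
      simp only [ih]
      rw [Function.comp_apply, Equiv.swap_apply_of_ne_of_ne (by simp [Fin.ext_iff])
        (by simp [Fin.ext_iff])]

/-- The iterated derivatives of a smooth function are symmetric. -/
lemma ContDiff.iteratedFDeriv_comp_perm {u : E → ℝ} (hu : ContDiff ℝ (⊤ : ℕ∞) u) {k : ℕ} (x : E)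
    (v : Fin k → E) (σ : Equiv.Perm (Fin k)) :
    iteratedFDeriv ℝ k u x (v ∘ σ) = iteratedFDeriv ℝ k u x v := by
  cases k with
  | zero => exact congrArg _ (Subsingleton.elim _ _)
  | succ k =>
    have hσ : σ ∈ Submonoid.closure
        (Set.range fun i : Fin k ↦ Equiv.swap i.castSucc i.succ) := by
      simp [Equiv.Perm.mclosure_swap_castSucc_succ]
    induction hσ using Submonoid.closure_induction generalizing v with
    | mem τ hτ =>
      obtain ⟨i, rfl⟩ := hτ
      exact iteratedFDeriv_comp_swap_castSucc_succ hu i x v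
    | one => rfl
    | mul σ τ _ _ hσ hτ => exact (hτ (v ∘ σ)).trans (hσ v)

/-- A nonzero iterated derivative is nonzero on some diagonal vector. -/
lemma exists_iteratedFDeriv_diagonal_ne_zero {u : E → ℝ} (hu : ContDiff ℝ (⊤ : ℕ∞) u) {x : E}
    {k : ℕ} (h : iteratedFDeriv ℝ k u x ≠ 0) :
    ∃ w : E, iteratedFDeriv ℝ k u x (fun _ ↦ w) ≠ 0 := by
  by_contra! hw
  refine h (ContinuousMultilinearMap.ext fun v ↦ ?_)
  have hsum := (iteratedFDeriv ℝ k u x).iteratedFDeriv_comp_diagonal 0 v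
  have hperm (σ : Equiv.Perm (Fin k)) :
      iteratedFDeriv ℝ k u x (fun i ↦ v (σ i)) = iteratedFDeriv ℝ k u x v :=
    hu.iteratedFDeriv_comp_perm x v σ
  simp only [hw, hperm] at hsum
  simpa [Nat.factorial_ne_zero, Fintype.card_perm] using hsum.symm

/-- The iterated derivatives along a line are the diagonal values of the iterated derivatives. -/
lemma iteratedDeriv_line_zero {u : E → ℝ} (hu : ContDiff ℝ (⊤ : ℕ∞) u) (x w : E) (k : ℕ) :
    iteratedDeriv k (fun t : ℝ ↦ u (x + t • w)) 0 = iteratedFDeriv ℝ k u x (fun _ ↦ w) := by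
  have hc : ContDiff ℝ k (fun y ↦ u (x + y)) :=
    (hu.of_le (by exact_mod_cast le_top)).comp (by fun_prop)
  have h := (ContinuousLinearMap.toSpanSingleton ℝ w).iteratedFDeriv_comp_right hc 0 le_rfl
  rw [iteratedDeriv_eq_iteratedFDeriv]
  change iteratedFDeriv ℝ k ((fun y ↦ u (x + y)) ∘ ContinuousLinearMap.toSpanSingleton ℝ w) 0 _ = _
  rw [h, iteratedFDeriv_comp_add_left]
  simp

/-- If the product of two smooth functions of one variable vanishes near a point, one of them has
a zero of infinite order there. -/
lemma iteratedDeriv_eq_zero_or_of_mul_eventually_eq_zero {φ ψ : ℝ → ℝ} {x : ℝ}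
    (hφ : ContDiff ℝ (⊤ : ℕ∞) φ) (hψ : ContDiff ℝ (⊤ : ℕ∞) ψ)
    (h : φ * ψ =ᶠ[𝓝 x] 0) :
    (∀ k, iteratedDeriv k φ x = 0) ∨ (∀ k, iteratedDeriv k ψ x = 0) := by
  classical
  by_contra! hne
  obtain ⟨hk, hl⟩ := hne
  have hprod : iteratedDeriv (Nat.find hk + Nat.find hl) (φ * ψ) x = 0 := by
    rw [h.iteratedDeriv_eq]
    simp
  rw [iteratedDeriv_mul (hφ.contDiffAt.of_le (by exact_mod_cast le_top))
    (hψ.contDiffAt.of_le (by exact_mod_cast le_top)),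
    Finset.sum_eq_single_of_mem (Nat.find hk) (by simp), Nat.add_sub_cancel_left] at hprod
  · have hchoose := (Nat.choose_pos (Nat.le_add_right (Nat.find hk) (Nat.find hl))).ne'
    exact mul_ne_zero (mul_ne_zero (by exact_mod_cast hchoose) (Nat.find_spec hk))
      (Nat.find_spec hl) hprod
  · intro i _ hi
    rcases lt_or_gt_of_ne hi with hi | hi
    · rw [not_not.mp (Nat.find_min hk hi)]
      simp
    · rw [not_not.mp (Nat.find_min hl (m := Nat.find hk + Nat.find hl - i)
        (by have := Nat.find_spec hl; grind))]
      simp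

/-- Two continuous multilinear forms whose diagonals are not identically zero have a common
diagonal vector on which neither vanishes. -/
lemma ContinuousMultilinearMap.exists_diagonal_ne_zero_and_ne_zero {k l : ℕ}
    (P : E [×k]→L[ℝ] ℝ) (Q : E [×l]→L[ℝ] ℝ)
    (hP : ∃ w, P (fun _ ↦ w) ≠ 0) (hQ : ∃ w, Q (fun _ ↦ w) ≠ 0) :
    ∃ w, P (fun _ ↦ w) ≠ 0 ∧ Q (fun _ ↦ w) ≠ 0 := by
  obtain ⟨a, ha⟩ := hP
  obtain ⟨b, hb⟩ := hQ
  by_contra! hPQ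
  have hline : AnalyticOnNhd ℝ (fun s : ℝ ↦ a + s • (b - a)) Set.univ := fun _ _ ↦ by fun_prop
  have analytic {m : ℕ} (R : E [×m]→L[ℝ] ℝ) :
      AnalyticOnNhd ℝ (fun s : ℝ ↦ R (fun _ ↦ a + s • (b - a))) Set.univ := fun s hs ↦
    R.analyticAt.comp (AnalyticAt.pi fun _ ↦ hline s hs)
  rcases (analytic P).eq_zero_or_eq_zero_of_mul_eq_zero (analytic Q)
    (fun s _ ↦ by
      by_cases hs : P (fun _ ↦ a + s • (b - a)) = 0
      · simp [hs]
      · simp [hPQ _ hs]) isPreconnected_univ with h | h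
  · exact ha (by simpa using h 0 trivial)
  · exact hb (by simpa using h 1 trivial)

/-- If the product of two smooth functions vanishes near a point, one of them has a zero of
infinite order there. -/
lemma iteratedFDeriv_eq_zero_or_of_mul_eventually_eq_zero {u v : E → ℝ} {x : E}
    (hu : ContDiff ℝ (⊤ : ℕ∞) u) (hv : ContDiff ℝ (⊤ : ℕ∞) v) (h : u * v =ᶠ[𝓝 x] 0) :
    (∀ k, iteratedFDeriv ℝ k u x = 0) ∨ (∀ k, iteratedFDeriv ℝ k v x = 0) := by
  by_contra! hne
  obtain ⟨⟨k, hk⟩, ⟨l, hl⟩⟩ := hne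
  obtain ⟨w, hwu, hwv⟩ := ContinuousMultilinearMap.exists_diagonal_ne_zero_and_ne_zero _ _
    (exists_iteratedFDeriv_diagonal_ne_zero hu hk) (exists_iteratedFDeriv_diagonal_ne_zero hv hl)
  have hline : ContDiff ℝ (⊤ : ℕ∞) (fun t : ℝ ↦ x + t • w) := by fun_prop
  have htendsto : Tendsto (fun t : ℝ ↦ x + t • w) (𝓝 0) (𝓝 x) := by
    simpa using hline.continuous.tendsto 0
  rcases iteratedDeriv_eq_zero_or_of_mul_eventually_eq_zero (hu.comp hline) (hv.comp hline)
    (htendsto.eventually h) with h0 | h0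
  · exact hwu ((iteratedDeriv_line_zero hu x w k).symm.trans (h0 k))
  · exact hwv ((iteratedDeriv_line_zero hv x w l).symm.trans (h0 l))

/-- The zeros of infinite order of a smooth function form a closed set. -/
lemma isClosed_setOf_iteratedFDeriv_eq_zero {u : E → ℝ} (hu : ContDiff ℝ (⊤ : ℕ∞) u) :
    IsClosed {x | ∀ k, iteratedFDeriv ℝ k u x = 0} := by
  simp only [Set.ofPred_forall]
  exact isClosed_iInter fun k ↦ isClosed_eq
    (hu.continuous_iteratedFDeriv (by exact_mod_cast le_top)) continuous_const

/-- If two smooth functions have zero product on a preconnected open set and no common zero of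
infinite order there, then one of them vanishes on that set. -/
lemma eq_zero_or_eq_zero_of_mul_eq_zero_of_no_common_flat_zero {u v : E → ℝ} {U : Set E}
    (hU : IsOpen U) (hconn : IsPreconnected U)
    (hu : ContDiff ℝ (⊤ : ℕ∞) u) (hv : ContDiff ℝ (⊤ : ℕ∞) v)
    (huv : ∀ x ∈ U, u x * v x = 0)
    (hflat : ∀ x ∈ U, (∀ k, iteratedFDeriv ℝ k u x = 0) → ¬ ∀ k, iteratedFDeriv ℝ k v x = 0) :
    (∀ x ∈ U, u x = 0) ∨ (∀ x ∈ U, v x = 0) := by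
  have hcover (x) (hx : x ∈ U) :=
    iteratedFDeriv_eq_zero_or_of_mul_eventually_eq_zero hu hv
      (eventually_of_mem (hU.mem_nhds hx) huv)
  have hzero {p : E → ℝ} {x : E} (h : ∀ k, iteratedFDeriv ℝ k p x = 0) : p x = 0 := by
    simpa using congrArg (fun L ↦ L 0) (h 0)
  by_contra! hne
  obtain ⟨⟨a, ha, hua⟩, ⟨b, hb, hvb⟩⟩ := hne
  obtain ⟨x, hx, hxu, hxv⟩ := isPreconnected_closed_iff.mp hconn _ _
    (isClosed_setOf_iteratedFDeriv_eq_zero hu) (isClosed_setOf_iteratedFDeriv_eq_zero hv) hcover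
    ⟨b, hb, (hcover b hb).resolve_right fun h ↦ hvb (hzero h)⟩
    ⟨a, ha, (hcover a ha).resolve_left fun h ↦ hua (hzero h)⟩
  exact hflat x hx hxu hxv

end SmoothProducts


/-- Appendix Lemma: a smooth function with no zeros of infinite order on a
nonempty open connected set `U ⊆ ℝⁿ` is determined on `U`, up to sign,
by its square. -/
theorem appendix_lemma (n : ℕ) (U : Set (EuclideanSpace ℝ (Fin n)))
    (hUopen : IsOpen U) (hUne : U.Nonempty) (hUconn : IsConnected U)
    (f g : EuclideanSpace ℝ (Fin n) → ℝ)
    (hf : ContDiff ℝ (⊤ : ℕ∞) f) (hg : ContDiff ℝ (⊤ : ℕ∞) g)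
    (hflat : ∀ x₀ ∈ U, ∃ k : ℕ, iteratedFDeriv ℝ k f x₀ ≠ 0)
    (hsq : ∀ x ∈ U, (g x) ^ 2 = (f x) ^ 2) :
    (∀ x ∈ U, g x = f x) ∨ (∀ x ∈ U, g x = -f x) := by
  have hdiff : ContDiff ℝ (⊤ : ℕ∞) (g - f) := hg.sub hf
  have hsum : ContDiff ℝ (⊤ : ℕ∞) (g + f) := hg.add hf
  have hf_eq : f = (2⁻¹ : ℝ) • ((g + f) - (g - f)) := by
    ext x
    simp only [Pi.smul_apply, Pi.sub_apply, Pi.add_apply, smul_eq_mul]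
    ring
  rcases eq_zero_or_eq_zero_of_mul_eq_zero_of_no_common_flat_zero hUopen hUconn.isPreconnected
    hdiff hsum
    (fun x hx ↦ by
      simp only [Pi.sub_apply, Pi.add_apply]
      linear_combination hsq x hx)
    (fun x hx hd hs ↦ by
      obtain ⟨k, hk⟩ := hflat x hx
      have hdk : ContDiffAt ℝ k (g - f) x := hdiff.contDiffAt.of_le (by exact_mod_cast le_top)
      have hsk : ContDiffAt ℝ k (g + f) x := hsum.contDiffAt.of_le (by exact_mod_cast le_top)
      refine hk ?_
      rw [hf_eq, iteratedFDeriv_const_smul_apply (f := (g + f) - (g - f)) (hsk.sub hdk),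
        iteratedFDeriv_sub_apply hsk hdk,
        hd, hs]
      simp) with h | h
  · exact Or.inl fun x hx ↦ sub_eq_zero.mp (h x hx)
  · exact Or.inr fun x hx ↦ eq_neg_of_add_eq_zero_left (h x hx)
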